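/- arXiv:1812.03131 — 5 statements merged into one kernel-verified Lean document; each statement's English description precedes it below -/
import Mathlib

section
/- Let 0 < β < 1 and let w, w' satisfy 1/2 < w ≤ w' < 1/(1+β). Suppose x, x_1, x_2 satisfy 0 < x_1 < x ≤ 1, 0 < x_2 ≤ 1, x = x_1 + x_2, and w' = w·β^{2x−2} / (w·β^{2x−2} + 1 − w) (so that w' is the first-option weight reached after two rounds in which the first option receives total penalty x). Then the penalty schedule (x, 0) strictly outperforms the schedule (x_1, x_2) for the adversary: w·x + (1 − w)(1 − x) + (1 − w)·β^{1−x} / (w·β^x + (1 − w)·β^{1−x}) > w·x_1 + (1 − w)(1 − x_1) + x_2·w·β^{x_1} / (w·β^{x_1} + (1 − w)·β^{1−x_1}) + (1 − x_2)·(1 − w)·β^{1−x_1} / (w·β^{x_1} + (1 − w)·β^{1−x_1}). -/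
lemma aux_G (β θ : ℝ) (hβ0 : 0 < β) (hβ1 : β < 1) (h0 : 0 < θ) (h1 : θ ≤ 1) :
    0 ≤ (1 - β ^ θ) * (1 + β) - θ * (1 - β) * (1 + β ^ θ) := by
  let G : ℝ → ℝ := fun b => (1 - θ) * (1 - b ^ (1 + θ)) + (1 + θ) * (b - b ^ θ)
  have hd : ∀ b : ℝ, 0 < b → HasDerivAt G
      ((1 - θ) * (-((1 + θ) * b ^ (1 + θ - 1))) + (1 + θ) * (1 - θ * b ^ (θ - 1))) b := by
    intro b hb
    have e1 := Real.hasDerivAt_rpow_const (x := b) (p := 1 + θ) (Or.inl hb.ne')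
    have e2 := Real.hasDerivAt_rpow_const (x := b) (p := θ) (Or.inl hb.ne')
    exact ((e1.const_sub 1).const_mul (1 - θ)).add (((hasDerivAt_id b).sub e2).const_mul (1 + θ))
  have hanti : AntitoneOn G (Set.Icc β 1) := by
    apply antitoneOn_of_deriv_nonpos (convex_Icc β 1)
    · intro b hb
      exact (hd b (lt_of_lt_of_le hβ0 hb.1)).continuousAt.continuousWithinAt
    · intro b hb
      rw [interior_Icc] at hb
      exact (hd b (hβ0.trans hb.1)).differentiableAt.differentiableWithinAt
    · intro b hb
      rw [interior_Icc] at hb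
      have hb0 := hβ0.trans hb.1
      rw [(hd b hb0).deriv]
      have am := Real.geom_mean_le_arith_mean2_weighted (w₁ := 1 - θ) (w₂ := θ)
        (p₁ := b ^ θ) (p₂ := b ^ (θ - 1)) (by linarith) h0.le (by positivity) (by positivity)
        (by ring)
      rw [← Real.rpow_mul hb0.le, ← Real.rpow_mul hb0.le, ← Real.rpow_add hb0,
        show θ * (1 - θ) + (θ - 1) * θ = 0 by ring, Real.rpow_zero] at am
      rw [show 1 + θ - 1 = θ by ring]
      nlinarith
  have h := hanti (Set.left_mem_Icc.2 hβ1.le) (Set.right_mem_Icc.2 hβ1.le) hβ1.le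
  simp only [G, Real.one_rpow] at h
  rw [Real.rpow_add hβ0, Real.rpow_one] at h
  nlinarith

lemma aux_P (β w y : ℝ) (hβ0 : 0 < β) (hw0 : 0 < w) (hw1 : w < 1) :
    w * β ^ y / (w * β ^ y + (1 - w) * β ^ (1 - y))
      = w * β ^ (2 * y - 1) / (w * β ^ (2 * y - 1) + (1 - w)) := by
  have e : β ^ y = β ^ (2 * y - 1) * β ^ (1 - y) := by
    rw [← Real.rpow_add hβ0]; congr 1; ring
  have hw2 : 0 < 1 - w := by linarith
  have a := Real.rpow_pos_of_pos hβ0 (1 - y)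
  have b := Real.rpow_pos_of_pos hβ0 (2 * y - 1)
  rw [e]
  field_simp

lemma aux_Q (β w y : ℝ) (hβ0 : 0 < β) (hw0 : 0 < w) (hw1 : w < 1) :
    (1 - w) * β ^ (1 - y) / (w * β ^ y + (1 - w) * β ^ (1 - y))
      = 1 - w * β ^ (2 * y - 1) / (w * β ^ (2 * y - 1) + (1 - w)) := by
  rw [← aux_P β w y hβ0 hw0 hw1]
  have hw2 : 0 < 1 - w := by linarith
  have a := Real.rpow_pos_of_pos hβ0 (1 - y)
  have b := Real.rpow_pos_of_pos hβ0 y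
  have : 0 < w * β ^ y + (1 - w) * β ^ (1 - y) := by positivity
  field_simp
  ring

set_option maxHeartbeats 2000000


theorem stmt_3 (β w w' x x₁ x₂ : ℝ)
    (hβ0 : 0 < β) (hβ1 : β < 1)
    (hw : 1 / 2 < w) (hww' : w ≤ w') (hw' : w' < 1 / (1 + β))
    (hx₁0 : 0 < x₁) (hx₁x : x₁ < x) (hx1 : x ≤ 1)
    (hx₂0 : 0 < x₂) (hx₂1 : x₂ ≤ 1)
    (hsum : x = x₁ + x₂)
    (htgt : w' = w * β ^ (2 * x - 2) / (w * β ^ (2 * x - 2) + 1 - w)) :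
    w * x + (1 - w) * (1 - x)
        + (1 - w) * β ^ (1 - x) / (w * β ^ x + (1 - w) * β ^ (1 - x))
      > w * x₁ + (1 - w) * (1 - x₁)
        + x₂ * (w * β ^ x₁) / (w * β ^ x₁ + (1 - w) * β ^ (1 - x₁))
        + (1 - x₂) * ((1 - w) * β ^ (1 - x₁)) / (w * β ^ x₁ + (1 - w) * β ^ (1 - x₁)) := by

  have hw0 : 0 < w := by linarith
  have hw1 : w < 1 := by
    have : 1 / (1 + β) < 1 := by rw [div_lt_one (by linarith)]; linarith
    linarith
  have hw2 : 0 < 1 - w := by linarith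
  rw [mul_div_assoc x₂, mul_div_assoc (1 - x₂), aux_P β w x₁ hβ0 hw0 hw1,
    aux_Q β w x₁ hβ0 hw0 hw1, aux_Q β w x hβ0 hw0 hw1]
  have hv0 := Real.rpow_pos_of_pos hβ0 (2 * x - 1)
  have hz0 := Real.rpow_pos_of_pos hβ0 (2 * x₁ - 1)
  have hvz : β ^ (2 * x - 1) < β ^ (2 * x₁ - 1) :=
    Real.rpow_lt_rpow_of_exponent_gt hβ0 hβ1 (by linarith)
  have hv1 : β ^ (2 * x - 1) < 1 := by
    have hc := Real.rpow_pos_of_pos hβ0 (2 * x - 2)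
    have e : β ^ (2 * x - 1) = β ^ (2 * x - 2) * β := by
      rw [← Real.rpow_add_one hβ0.ne']; congr 1; ring
    rw [htgt, div_lt_div_iff₀ (by nlinarith [mul_pos hw0 hc]) (by linarith)] at hw'
    rw [e]
    nlinarith
  have hz2 : β * β ^ (2 * x₁ - 1) ≤ 1 := by
    rw [mul_comm, ← Real.rpow_add_one hβ0.ne']
    exact Real.rpow_le_one hβ0.le hβ1.le (by linarith)
  have hθ : 2 * x - 1 > 0 := by
    by_contra hcon
    have := Real.one_le_rpow_of_pos_of_le_one_of_nonpos hβ0 hβ1.le (not_lt.1 hcon)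
    linarith
  have hG := aux_G β (2 * x - 1) hβ0 hβ1 hθ (by linarith)
  have hB : β ^ (2 * x - 1) ≤ 1 - (2 * x - 1) * (1 - β) := by
    have := rpow_one_add_le_one_add_mul_self (s := β - 1) (by linarith) hθ.le
      (show 2 * x - 1 ≤ 1 by linarith)
    rw [show 1 + (β - 1) = β by ring] at this
    linarith
  generalize β ^ (2 * x - 1) = v at *
  generalize β ^ (2 * x₁ - 1) = z at *
  have hdv : 0 < w * v + (1 - w) := by positivity
  have hdz : 0 < w * z + (1 - w) := by positivity
  have hdb : 0 < w + (1 - w) * β := by positivity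
  have hS2 : w - w * v / (w * v + (1 - w)) = w * (1 - w) * (1 - v) / (w * v + (1 - w)) := by
    field_simp
    ring
  have hS2pos : 0 < w * (1 - w) * (1 - v) / (w * v + (1 - w)) :=
    div_pos (mul_pos (mul_pos hw0 hw2) (by linarith)) hdv
  have hPP : w * v / (w * v + (1 - w)) < w * z / (w * z + (1 - w)) := by
    rw [div_lt_div_iff₀ hdv hdz]
    nlinarith [mul_pos hw0 hw2]
  have hS1 : w * z / (w * z + (1 - w)) - w ≤ w * (1 - w) * (1 - β) / (w + (1 - w) * β) := by
    have e : w * (1 - w) * (1 - β) / (w + (1 - w) * β) = w / (w + (1 - w) * β) - w := by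
      field_simp
      ring
    rw [e]
    have : w * z / (w * z + (1 - w)) ≤ w / (w + (1 - w) * β) := by
      rw [div_le_div_iff₀ hdz hdb]
      nlinarith [mul_pos hw0 hw2]
    linarith
  have hM : 0 < w * (1 - w) * (1 - β) / (w + (1 - w) * β) :=
    div_pos (mul_pos (mul_pos hw0 hw2) (by linarith)) hdb
  have hkey : (2 * x - 1) * (w * (1 - w) * (1 - β) / (w + (1 - w) * β))
      ≤ w * (1 - w) * (1 - v) / (w * v + (1 - w)) := by
    rw [← mul_div_assoc, div_le_div_iff₀ hdb hdv]
    have h2 : 0 ≤ (1 - v) - (2 * x - 1) * (1 - β) * v := by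
      have : 0 ≤ (2 * x - 1) * (1 - β) := mul_nonneg hθ.le (by linarith)
      nlinarith
    have h3 : (2 * x - 1) * (1 - β) * (w * v + (1 - w)) ≤ (1 - v) * (w + (1 - w) * β) := by
      have h4 := mul_nonneg hw2.le hG
      have h5 := mul_nonneg (show 0 ≤ 2 * w - 1 by linarith) h2
      nlinarith
    have := mul_le_mul_of_nonneg_left h3 (mul_pos hw0 hw2).le
    nlinarith
  generalize w * (1 - w) * (1 - β) / (w + (1 - w) * β) = M at *
  generalize w * (1 - w) * (1 - v) / (w * v + (1 - w)) = S at *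
  generalize w * v / (w * v + (1 - w)) = p at *
  generalize w * z / (w * z + (1 - w)) = q at *
  have main : 0 < 2 * x₂ * (w - q) + q - p := by
    rcases le_or_gt (2 * x₂) 1 with h | h
    · nlinarith [mul_nonneg (sub_nonneg.2 h) (sub_pos.2 hPP).le,
        mul_pos hx₂0 (show 0 < w - p by linarith)]
    · have h6 : (2 * x₂ - 1) * (q - w) ≤ (2 * x₂ - 1) * M :=
        mul_le_mul_of_nonneg_left hS1 (by linarith)
      have h7 : (2 * x₂ - 1) * M < (2 * x - 1) * M :=
        mul_lt_mul_of_pos_right (by linarith) hM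
      nlinarith
  subst hsum
  nlinarith
end

section
/- Let 0 < β < 1 and let w, w' satisfy 1/2 < w' ≤ w < 1/(1+β). Suppose x, x_1, x_2 satisfy 0 < x ≤ 1, 0 < x_1 < 1, x < x_2 ≤ 1, x_1 + x_2 = 1 + x, and w' = w·β^{2x} / (w·β^{2x} + 1 − w) (so that w' is the first-option weight reached after two rounds in which the first option receives total penalty 1 + x). Then the penalty schedule (1, x) strictly outperforms the schedule (x_1, x_2) for the adversary: w + x·w·β / (w·β + 1 − w) + (1 − x)·(1 − w) / (w·β + 1 − w) > w·x_1 + (1 − w)(1 − x_1) + x_2·w·β^{x_1} / (w·β^{x_1} + (1 − w)·β^{1−x_1}) + (1 − x_2)·(1 − w)·β^{1−x_1} / (w·β^{x_1} + (1 − w)·β^{1−x_1}). -/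
lemma aux_tanh_log (P Q u : ℝ) (hP : 0 < P) (hQ : 0 < Q) (hu : 2 * u = Real.log P - Real.log Q) :
    Real.tanh u = (P - Q) / (P + Q) := by
  have h1 : Real.exp u * Real.exp u * Q = P := by
    rw [← Real.exp_add, ← two_mul, hu, Real.exp_sub, Real.exp_log hP, Real.exp_log hQ]
    field_simp
  have h2 := Real.exp_pos u
  rw [Real.tanh_eq_sinh_div_cosh, Real.sinh_eq, Real.cosh_eq, Real.exp_neg, ← h1]
  field_simp

lemma aux_sub (v c : ℝ) : Real.tanh v - Real.tanh c
    = Real.tanh (v - c) * (1 - Real.tanh v * Real.tanh c) := by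
  have h1 := Real.cosh_pos v
  have h2 := Real.cosh_pos c
  have h3 := Real.cosh_pos (v - c)
  simp only [Real.tanh_eq_sinh_div_cosh]
  rw [Real.cosh_sub] at h3
  rw [Real.cosh_sub, Real.sinh_sub]
  field_simp

lemma aux_add (v c : ℝ) : Real.tanh v + Real.tanh c
    = Real.tanh (v + c) * (1 + Real.tanh v * Real.tanh c) := by
  have := aux_sub v (-c)
  simp only [Real.tanh_neg, sub_neg_eq_add] at this
  rw [this]; ring

lemma aux_pos {z : ℝ} (h : 0 < z) : 0 < Real.tanh z := by
  rw [Real.tanh_eq_sinh_div_cosh]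
  exact div_pos (Real.sinh_pos_iff.2 h) (Real.cosh_pos z)

lemma aux_lt (z : ℝ) : Real.tanh z < 1 := by
  rw [Real.tanh_eq_sinh_div_cosh, div_lt_one (Real.cosh_pos z)]
  exact Real.sinh_lt_cosh z

lemma aux_gt (z : ℝ) : -1 < Real.tanh z := by
  have := aux_lt (-z)
  rw [Real.tanh_neg] at this
  linarith

lemma aux_mono {a b : ℝ} (h : a ≤ b) : Real.tanh a ≤ Real.tanh b := by
  have h1 := aux_sub b a
  rcases h.eq_or_lt with rfl | h
  · rfl
  have h2 := aux_pos (sub_pos.2 h)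
  have := aux_lt a
  have := aux_lt b
  have := aux_gt a
  have := aux_gt b
  have : 0 < 1 - Real.tanh b * Real.tanh a := by nlinarith
  nlinarith

lemma aux_sinh {m M : ℝ} (hm : 0 ≤ m) (h : m ≤ M) :
    M * Real.sinh m ≤ m * Real.sinh M := by
  have hc : ConvexOn ℝ (Set.Ici 0) Real.sinh := by
    apply MonotoneOn.convexOn_of_deriv (convex_Ici 0) Real.continuous_sinh.continuousOn
      Real.differentiable_sinh.differentiableOn
    rw [Real.deriv_sinh, interior_Ici]
    intro a ha b hb hab
    simp only [Set.mem_Ioi] at ha hb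
    rw [Real.cosh_le_cosh, abs_of_pos ha, abs_of_pos hb]; exact hab
  rcases hm.eq_or_lt with rfl | hm
  · simp
  have hM : 0 < M := by linarith
  have := hc.2 (Set.mem_Ici.2 hM.le) (Set.mem_Ici.2 le_rfl)
    (show 0 ≤ m / M by positivity)
    (show 0 ≤ 1 - m / M by rw [sub_nonneg, div_le_one hM]; exact h) (by ring)
  simp only [smul_eq_mul, mul_zero, add_zero, Real.sinh_zero] at this
  rw [div_mul_cancel₀ _ hM.ne'] at this
  calc M * Real.sinh m ≤ M * (m / M * Real.sinh M) := by gcongr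
    _ = _ := by field_simp

lemma aux_ratio {m M : ℝ} (hm : 0 ≤ m) (h : m ≤ M) :
    m * Real.tanh M ≤ M * Real.tanh m := by
  have h1 := aux_sinh (m := M - m) (M := M + m) (by linarith) (by linarith)
  have h2 := Real.cosh_pos m
  have h3 := Real.cosh_pos M
  rw [Real.sinh_add, Real.sinh_sub] at h1
  rw [Real.tanh_eq_sinh_div_cosh, Real.tanh_eq_sinh_div_cosh, ← mul_div_assoc, ← mul_div_assoc,
    div_le_div_iff₀ h3 h2]
  nlinarith

lemma aux_key {v c : ℝ} (hc : 0 ≤ c) (h : c ≤ v) :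
    v * Real.tanh v - c * Real.tanh c ≤ (v + c) * Real.tanh (v - c) := by
  have h1 := aux_sub v c
  have h2 := aux_add v c
  have h3 := aux_ratio (m := v - c) (M := v + c) (by linarith) (by linarith)
  have : 0 < 1 + Real.tanh v * Real.tanh c := by
    have := aux_lt v
    have := aux_lt c
    have := aux_gt v
    have := aux_gt c
    nlinarith
  have h4 := mul_le_mul_of_nonneg_right h3 this.le
  have e : 2 * (v * Real.tanh v - c * Real.tanh c) = (v + c) * (Real.tanh v - Real.tanh c)
     + (v - c) * (Real.tanh v + Real.tanh c) := by ring
  rw [h1, h2] at e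
  linarith

lemma aux_core {H C Y S : ℝ} (hC : 0 < C) (hCH : C < H) (hY : C < Y) (hS : 0 < S)
    (hSY : S - Y ≤ H) :
    0 < S * Real.tanh (H - C) + Y * Real.tanh C - (S - Y) * Real.tanh (S - C) := by
  have hp := aux_pos (sub_pos.2 hCH)
  have hq := aux_pos hC
  have hco : 0 < Real.tanh C + Real.tanh (S - C) := by
    rw [aux_add]
    have := aux_pos (z := C + (S - C)) (by linarith)
    have := aux_lt C
    have := aux_lt (S - C)
    have := aux_gt C
    have := aux_gt (S - C)
    apply mul_pos
    · assumption
    · nlinarith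
  rcases le_or_gt S (H + C) with h | h
  · have hmain : 0 ≤ S * Real.tanh (H - C) + C * Real.tanh C - (S - C) * Real.tanh (S - C) := by
      rcases le_or_gt C (S - C) with h' | h'
      · have h1 := aux_key hC.le h'
        have h2 := aux_mono (a := S - C - C) (b := H - C) (by linarith)
        have h3 := mul_le_mul_of_nonneg_left h2 hS.le
        have h4 : S - C + C = S := by ring
        rw [h4] at h1
        linarith
      · have : (S - C) * Real.tanh (S - C) ≤ C * Real.tanh C := by
          rcases le_or_gt 0 (S - C) with h0 | h0
          · have h2 := aux_mono h'.le
            nlinarith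
          · have h2 := aux_mono (a := -(S - C)) (b := C) (by linarith)
            rw [Real.tanh_neg] at h2
            nlinarith
        have := mul_pos hS hp
        linarith
    nlinarith [mul_pos (sub_pos.2 hY) hco]
  · have h1 := aux_key hC.le hCH.le
    have h2 := aux_ratio (m := H) (M := S - C) (by linarith) (by linarith)
    have h3 : Real.tanh H < Real.tanh (H - C) + Real.tanh C := by
      rw [aux_add, sub_add_cancel]
      have := aux_pos (hC.trans hCH)
      have := mul_pos this (mul_pos hp hq)
      linarith
    have h4 := mul_pos (sub_pos.2 h) (sub_pos.2 h3)
    have h5 : 0 ≤ (Y - (S - H)) * (Real.tanh C + Real.tanh (S - C)) :=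
      mul_nonneg (by linarith) hco.le
    nlinarith

theorem stmt_4 (β w w' x x₁ x₂ : ℝ)
    (hβ0 : 0 < β) (hβ1 : β < 1)
    (hw' : 1 / 2 < w') (hw'w : w' ≤ w) (hw : w < 1 / (1 + β))
    (hx0 : 0 < x) (hx1 : x ≤ 1)
    (hx₁0 : 0 < x₁) (hx₁1 : x₁ < 1)
    (hxx₂ : x < x₂) (hx₂1 : x₂ ≤ 1)
    (hsum : x₁ + x₂ = 1 + x)
    (htgt : w' = w * β ^ (2 * x) / (w * β ^ (2 * x) + 1 - w)) :
    w + x * (w * β) / (w * β + 1 - w) + (1 - x) * (1 - w) / (w * β + 1 - w)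
      > w * x₁ + (1 - w) * (1 - x₁)
        + x₂ * (w * β ^ x₁) / (w * β ^ x₁ + (1 - w) * β ^ (1 - x₁))
        + (1 - x₂) * ((1 - w) * β ^ (1 - x₁)) / (w * β ^ x₁ + (1 - w) * β ^ (1 - x₁)) := by
  have hwh : 1 / 2 < w := by linarith
  have hw0 : 0 < w := by linarith
  rw [lt_div_iff₀ (by linarith)] at hw
  have hwb : 0 < w * β := by positivity
  have hv0 : 0 < 1 - w := by nlinarith
  have hη : Real.log β < 0 := Real.log_neg hβ0 hβ1
  have hA : Real.log (1 - w) < Real.log w := Real.log_lt_log hv0 (by linarith)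
  have hB : Real.log w + Real.log β < Real.log (1 - w) := by
    rw [← Real.log_mul hw0.ne' hβ0.ne']
    exact Real.log_lt_log hwb (by linarith)
  have hT : Real.log (1 - w) < Real.log w + 2 * x * Real.log β := by
    have hb : 0 < β ^ (2 * x) := Real.rpow_pos_of_pos hβ0 _
    rw [← Real.log_rpow hβ0, ← Real.log_mul hw0.ne' hb.ne']
    apply Real.log_lt_log hv0
    have := mul_pos hw0 hb
    rw [htgt, div_lt_div_iff₀ (by norm_num) (by linarith)] at hw'
    linarith
  obtain ⟨P, hP⟩ : ∃ P, P = w * β ^ x₁ := ⟨_, rfl⟩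
  obtain ⟨Q, hQ⟩ : ∃ Q, Q = (1 - w) * β ^ (1 - x₁) := ⟨_, rfl⟩
  have hb1 : 0 < β ^ x₁ := Real.rpow_pos_of_pos hβ0 _
  have hb2 : 0 < β ^ (1 - x₁) := Real.rpow_pos_of_pos hβ0 _
  have hP0 : 0 < P := by rw [hP]; positivity
  have hQ0 : 0 < Q := by rw [hQ]; positivity
  have lP : Real.log P = Real.log w + x₁ * Real.log β := by
    rw [hP, Real.log_mul hw0.ne' hb1.ne', Real.log_rpow hβ0]
  have lQ : Real.log Q = Real.log (1 - w) + (1 - x₁) * Real.log β := by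
    rw [hQ, Real.log_mul hv0.ne' hb2.ne', Real.log_rpow hβ0]
  rw [← hP, ← hQ]
  obtain ⟨η, hηd⟩ : ∃ η, η = -Real.log β := ⟨_, rfl⟩
  have hη0 : 0 < η := by linarith
  have e : Real.log β = -η := by linarith
  rw [e] at lP lQ hT hB
  obtain ⟨C, hC⟩ : ∃ C, C = (η - (Real.log w - Real.log (1 - w))) / 2 := ⟨_, rfl⟩
  have hcore := aux_core (H := η / 2) (C := C) (Y := η * (1 / 2 - x)) (S := η * (1 - x₁))
    (by linarith) (by linarith) (by linarith) (mul_pos hη0 (by linarith)) (by nlinarith)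
  rw [aux_tanh_log w (1 - w) (η / 2 - C) hw0 hv0 (by rw [hC]; ring),
    aux_tanh_log (1 - w) (w * β) C hv0 hwb
      (by rw [hC, Real.log_mul hw0.ne' hβ0.ne', e]; ring),
    aux_tanh_log P Q _ hP0 hQ0 (by rw [hC, lP, lQ]; ring)] at hcore
  have h2 : 0 < (1 - x₁) * ((w - (1 - w)) / (w + (1 - w)))
      + (1 / 2 - x) * ((1 - w - w * β) / (1 - w + w * β))
      - (1 / 2 + x - x₁) * ((P - Q) / (P + Q)) := by
    apply pos_of_mul_pos_right (a := η) _ hη0.le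
    linarith
  have hx₂ : x₂ = 1 + x - x₁ := by linarith
  have i1 : x * (w * β) / (w * β + 1 - w) + (1 - x) * (1 - w) / (w * β + 1 - w)
      = 1 / 2 + (1 / 2 - x) * ((1 - w - w * β) / (1 - w + w * β)) := by
    have : w * β + 1 - w = 1 - w + w * β := by ring
    rw [this]
    have : 0 < 1 - w + w * β := by linarith
    field_simp
    ring
  have i2 : x₂ * P / (P + Q) + (1 - x₂) * Q / (P + Q)
      = 1 / 2 + (1 / 2 + x - x₁) * ((P - Q) / (P + Q)) := by
    rw [hx₂]
    field_simp
    ring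
  have i3 : (w - (1 - w)) / (w + (1 - w)) = 2 * w - 1 := by
    have : w + (1 - w) = 1 := by ring
    rw [this]; ring
  rw [i3] at h2
  linarith
end

section
/- Let 0 < β < 1 and define L_p(w) = w + (1 − w)/(w·β + 1 − w) for w ∈ [0,1]; L_p(w) is the total loss inflicted on a Hedge player over one two-round rotation cycle that starts with first-option weight w and uses penalty vectors (1,0) then (0,1). Then for all w ∈ [0,1] one has L_p(w) ≤ 2/(1 + √β), with equality if and only if w = 1/(1 + √β). In particular the optimal rotational weight pair is (1/(1 + √β), √β/(1 + √β)), yielding a constant adversarial gain of 1/(1 + √β) per round. -/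
theorem stmt_6 (β : ℝ) (hβ0 : 0 < β) (hβ1 : β < 1) :
    ∀ w ∈ Set.Icc (0 : ℝ) 1,
      (w + (1 - w) / (w * β + 1 - w) ≤ 2 / (1 + Real.sqrt β)) ∧
      (w + (1 - w) / (w * β + 1 - w) = 2 / (1 + Real.sqrt β)
        ↔ w = 1 / (1 + Real.sqrt β)) := by
  rintro w ⟨hw0, hw1⟩
  obtain ⟨s, hs⟩ : ∃ s, s = Real.sqrt β := ⟨_, rfl⟩
  have hs0 : 0 < s := hs ▸ Real.sqrt_pos.mpr hβ0
  have hsq : β = s ^ 2 := by rw [hs, Real.sq_sqrt hβ0.le]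
  rw [← hs]
  clear hs
  subst hsq
  have hs1 : s < 1 := by nlinarith
  have hD : 0 < w * s ^ 2 + 1 - w := by nlinarith
  have h1 : 0 < 1 + s := by linarith
  have hc : 0 < (1 - s) / ((1 + s) * (w * s ^ 2 + 1 - w)) :=
    div_pos (by linarith) (mul_pos h1 hD)
  have key : 2 / (1 + s) - (w + (1 - w) / (w * s ^ 2 + 1 - w))
      = (1 - s) / ((1 + s) * (w * s ^ 2 + 1 - w)) * (w * (1 + s) - 1) ^ 2 := by
    have hD' := hD.ne'
    have h1' := h1.ne'
    rw [div_mul_eq_mul_div, eq_div_iff (mul_ne_zero h1' hD'), sub_mul, add_mul w]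
    have e1 : 2 / (1 + s) * ((1 + s) * (w * s ^ 2 + 1 - w)) = 2 * (w * s ^ 2 + 1 - w) := by
      rw [← mul_assoc, div_mul_cancel₀ _ h1']
    have e2 : (1 - w) / (w * s ^ 2 + 1 - w) * ((1 + s) * (w * s ^ 2 + 1 - w))
        = (1 - w) * (1 + s) := by
      rw [mul_comm (1 + s), ← mul_assoc, div_mul_cancel₀ _ hD']
    rw [e1, e2]
    ring
  constructor
  · have := mul_nonneg hc.le (sq_nonneg (w * (1 + s) - 1))
    linarith
  · rw [eq_div_iff (a := (1:ℝ)) h1.ne']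
    constructor
    · intro h
      rw [h, sub_self] at key
      have := (mul_eq_zero.mp key.symm).resolve_left hc.ne'
      have := pow_eq_zero_iff (two_ne_zero) |>.mp this
      linarith
    · intro h
      rw [h, sub_self, zero_pow two_ne_zero, mul_zero] at key
      linarith
end

section
/- Let 0 < β < 1 and let k be a positive integer. The function g(x) = k·β^{1−x}/(β^x + β^{1−x}) + k·β^x/(β^x + β^{2−x}), defined for x ∈ [0,1], satisfies g(x) ≤ 2k/(1 + √β) for all x ∈ [0,1], with equality if and only if x = 3/4. (g(x) is the total loss accumulated during k full two-round rotation cycles of the Hedge game that started from equal weights (1/2,1/2) with first-round first-option penalty x.) -/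
theorem stmt_11 (β : ℝ) (k : ℕ) (hβ0 : 0 < β) (hβ1 : β < 1) (hk : 0 < k) :
    ∀ x ∈ Set.Icc (0 : ℝ) 1,
      ((k : ℝ) * β ^ (1 - x) / (β ^ x + β ^ (1 - x))
          + (k : ℝ) * β ^ x / (β ^ x + β ^ (2 - x))
        ≤ 2 * (k : ℝ) / (1 + Real.sqrt β)) ∧
      ((k : ℝ) * β ^ (1 - x) / (β ^ x + β ^ (1 - x))
          + (k : ℝ) * β ^ x / (β ^ x + β ^ (2 - x))
        = 2 * (k : ℝ) / (1 + Real.sqrt β) ↔ x = 3 / 4) := by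
  intro x _
  have hK : (0 : ℝ) < k := by exact_mod_cast hk
  have ha : 0 < β ^ x := Real.rpow_pos_of_pos hβ0 x
  have hs : 0 < Real.sqrt β := Real.sqrt_pos.mpr hβ0
  have hss : β = Real.sqrt β ^ 2 := (Real.sq_sqrt hβ0.le).symm
  have hs1 : Real.sqrt β < 1 := by nlinarith
  have h1 : β ^ (1 - x) = Real.sqrt β ^ 2 / β ^ x := by
    rw [← hss, Real.rpow_sub hβ0, Real.rpow_one]
  have h2 : β ^ (2 - x) = Real.sqrt β ^ 4 / β ^ x := by
    rw [Real.rpow_sub hβ0, Real.rpow_two]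
    congr 1
    nth_rewrite 1 [hss]
    ring
  have heq : (β ^ x) ^ 2 = Real.sqrt β ^ 3 ↔ x = 3 / 4 := by
    have e1 : (β ^ x) ^ 2 = β ^ (x * 2) := by
      rw [Real.rpow_mul hβ0.le, Real.rpow_two]
    have e2 : Real.sqrt β ^ 3 = β ^ ((3 : ℝ) / 2) := by
      rw [Real.sqrt_eq_rpow, ← Real.rpow_natCast, ← Real.rpow_mul hβ0.le]
      norm_num
    rw [e1, e2, Real.rpow_right_inj hβ0 hβ1.ne]
    constructor <;> intro h <;> linarith
  rw [h1, h2, ← heq]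
  generalize β ^ x = a at *
  generalize Real.sqrt β = s at *
  have key : 2 * (k : ℝ) / (1 + s) - ((k : ℝ) * (s ^ 2 / a) / (a + s ^ 2 / a)
      + (k : ℝ) * a / (a + s ^ 4 / a))
      = (k * (1 - s) / ((1 + s) * (a ^ 2 + s ^ 2) * (a ^ 2 + s ^ 4))) * (a ^ 2 - s ^ 3) ^ 2 := by
    have : 1 + s ≠ 0 := by positivity
    have : a ^ 2 + s ^ 2 ≠ 0 := by positivity
    have : a ^ 2 + s ^ 4 ≠ 0 := by positivity
    field_simp
    ring
  have hc : 0 < (k * (1 - s) / ((1 + s) * (a ^ 2 + s ^ 2) * (a ^ 2 + s ^ 4))) := by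
    have : 0 < 1 - s := by linarith
    positivity
  constructor
  · have := mul_nonneg hc.le (sq_nonneg (a ^ 2 - s ^ 3))
    linarith
  · constructor
    · intro h
      rw [h, sub_self] at key
      rcases mul_eq_zero.mp key.symm with h' | h'
      · exact absurd h' hc.ne.symm
      · exact sub_eq_zero.mp (pow_eq_zero_iff (two_ne_zero) |>.mp h')
    · intro h
      rw [h, sub_self] at key
      rw [← h] at key
      have : (0:ℝ) ^ 2 = 0 := by norm_num
      rw [this, mul_zero] at key
      linarith
end

section
/- Let 0 < β < 1 and let w ∈ [1/2, 1/(1+β)] (the 'intersection area'). Define the two-round rotation-cycle loss L'(w) = w + 1 − w·β/(w·β + 1 − w). Then 1/2 + 1/(1 + β) ≤ L'(w) ≤ 2/(1 + √β); the lower bound is attained exactly at the endpoints w = 1/2 and w = 1/(1+β), and the upper bound is attained exactly at w = 1/(1 + √β). -/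
theorem stmt_17 (β : ℝ) (hβ0 : 0 < β) (hβ1 : β < 1) :
    ∀ w ∈ Set.Icc (1 / 2 : ℝ) (1 / (1 + β)),
      (1 / 2 + 1 / (1 + β) ≤ w + 1 - w * β / (w * β + 1 - w) ∧
        w + 1 - w * β / (w * β + 1 - w) ≤ 2 / (1 + Real.sqrt β)) ∧
      (w + 1 - w * β / (w * β + 1 - w) = 1 / 2 + 1 / (1 + β)
        ↔ w = 1 / 2 ∨ w = 1 / (1 + β)) ∧
      (w + 1 - w * β / (w * β + 1 - w) = 2 / (1 + Real.sqrt β)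
        ↔ w = 1 / (1 + Real.sqrt β)) := by
  rintro w ⟨h1, h2⟩
  have hs0 : 0 < Real.sqrt β := Real.sqrt_pos.2 hβ0
  have hs : Real.sqrt β ^ 2 = β := Real.sq_sqrt hβ0.le
  generalize Real.sqrt β = s at hs0 hs ⊢
  have hb : 0 < 1 - β := by linarith
  have hw1 : w < 1 := lt_of_le_of_lt h2 (by rw [div_lt_one (by linarith)]; linarith)
  have hD : 0 < w * β + 1 - w := by
    have : 0 < w * β := mul_pos (by linarith) hβ0
    linarith
  have e1 : w + 1 - w * β / (w * β + 1 - w) - (1 / 2 + 1 / (1 + β))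
      = (1 - β) / (w * β + 1 - w) * ((w - 1 / 2) * (1 / (1 + β) - w)) := by
    have := hD.ne'
    have : 1 + β ≠ 0 := by linarith
    field_simp
    ring
  have e2 : 2 / (1 + s) - (w + 1 - w * β / (w * β + 1 - w))
      = (1 - β) / (w * β + 1 - w) * (w - 1 / (1 + s)) ^ 2 := by
    have := hD.ne'
    have : 1 + s ≠ 0 := by linarith
    field_simp
    subst hs
    ring
  have hk : 0 < (1 - β) / (w * β + 1 - w) := div_pos hb hD
  generalize w + 1 - w * β / (w * β + 1 - w) = L at e1 e2 ⊢
  generalize (1 - β) / (w * β + 1 - w) = k at e1 e2 hk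
  refine ⟨⟨?_, ?_⟩, ?_, ?_⟩
  · have := mul_nonneg hk.le (mul_nonneg (sub_nonneg.2 h1) (sub_nonneg.2 h2))
    linarith
  · have := mul_nonneg hk.le (sq_nonneg (w - 1 / (1 + s)))
    linarith
  · rw [← sub_eq_zero, e1, mul_eq_zero, mul_eq_zero, sub_eq_zero, sub_eq_zero,
      or_iff_right hk.ne', eq_comm (a := 1 / (1 + β))]
  · rw [eq_comm, ← sub_eq_zero, e2, mul_eq_zero, or_iff_right hk.ne',
      sq_eq_zero_iff, sub_eq_zero]
end
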